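/- Let 𝒢 = {G_1,…,G_g} be a partition of 𝒩 = {1,…,n} with l_min ≤ |G_j| ≤ l_max ≤ k for all j, set s_max = ⌊k/l_min⌋, let μ ∈ [0,1], and let ‖z‖_{SGL,μ} := Σ_{j=1}^g [(1−μ)‖z_{G_j}‖₁ + μ‖z_{G_j}‖₂] be the sparse group LASSO norm. Set d = (1−μ)√l_max + μ√s_max. Suppose A ∈ ℝ^{m×n} satisfies GRIP of order 2k with constant δ = δ_{2k} satisfying δ < 1/(1 + √2·d). Let x ∈ ℝ^n, y = Ax + η with ‖η‖₂ ≤ ε, and let x̂ minimize ‖z‖_{SGL,μ} over all z with ‖y − Az‖₂ ≤ ε. Then ‖x̂ − x‖₂ ≤ 2·(1 + (√2−1)δ)/(1 − (1 + √2·d)δ)·σ_{k,𝒢}(x,‖·‖_{SGL,μ}) + 2(1 + d)·√(1+δ)/(1 − (1 + √2·d)δ)·ε. -/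

import Mathlib

noncomputable section

open Finset

/-- The restriction `x_Λ` of `x : ℝ^n` to the coordinates in `Λ` (zero outside `Λ`). -/
def restr {n : ℕ} (Λ : Finset (Fin n)) (x : Fin n → ℝ) : Fin n → ℝ :=
  fun i => if i ∈ Λ then x i else 0

/-- The Euclidean norm on `ℝ^n`. -/
def norm2 {n : ℕ} (x : Fin n → ℝ) : ℝ := Real.sqrt (∑ i, (x i) ^ 2)

/-- The ℓ₁-norm on `ℝ^n`. -/
def norm1 {n : ℕ} (x : Fin n → ℝ) : ℝ := ∑ i, |x i|

/-- `Λ` is a group `t`-sparse set: a union of groups of the partition `G`, of cardinality `≤ t`. -/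
def GkS {n g : ℕ} (G : Fin g → Finset (Fin n)) (t : ℕ) (Λ : Finset (Fin n)) : Prop :=
  (∃ S : Finset (Fin g), Λ = S.biUnion G) ∧ Λ.card ≤ t

/-- `A` satisfies the group restricted isometry property of order `t` with constant `δ`. -/
def GRIP {m n g : ℕ} (G : Fin g → Finset (Fin n)) (A : Matrix (Fin m) (Fin n) ℝ)
    (t : ℕ) (δ : ℝ) : Prop :=
  ∀ z : Fin n → ℝ, (∃ Λ : Finset (Fin n), GkS G t Λ ∧ Function.support z ⊆ ↑Λ) →
    (1 - δ) * (norm2 z) ^ 2 ≤ (norm2 (A.mulVec z)) ^ 2 ∧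
    (norm2 (A.mulVec z)) ^ 2 ≤ (1 + δ) * (norm2 z) ^ 2

section SelectionOfLargestTerms

variable {ι : Type*} [DecidableEq ι]

lemma exists_top_subset (a : ι → ℝ) (U : Finset ι) (q : ℕ) (hq : q ≤ U.card) :
    ∃ T ⊆ U, T.card = q ∧ ∀ i ∈ T, ∀ j ∈ U \ T, a j ≤ a i := by
  induction q with
  | zero => exact ⟨∅, by simp, by simp, by simp⟩
  | succ q ih =>
    obtain ⟨T, hTU, hTc, hT⟩ := ih (by omega)
    have hne : (U \ T).Nonempty := by
      rw [← Finset.card_pos, Finset.card_sdiff_of_subset hTU]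
      omega
    obtain ⟨p, hp, hpmax⟩ := Finset.exists_max_image (U \ T) a hne
    have hp' := Finset.mem_sdiff.1 hp
    refine ⟨insert p T, Finset.insert_subset hp'.1 hTU, ?_, ?_⟩
    · rw [Finset.card_insert_of_notMem hp'.2, hTc]
    · intro i hi j hj
      have hj' : j ∈ U \ T := by
        simp only [Finset.mem_sdiff, Finset.mem_insert, not_or] at hj ⊢
        exact ⟨hj.1, hj.2.2⟩
      rcases Finset.mem_insert.1 hi with rfl | hi
      · exact hpmax j hj'
      · exact hT i hi j hj'

/-- Selecting (up to) `q` largest terms of `a` on `U`: `m` is the largest selected term and `α`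
separates the selected terms from the others. -/
lemma exists_top_block (a : ι → ℝ) (ha : ∀ i, 0 ≤ a i) (U : Finset ι) (q : ℕ) (hq : 1 ≤ q) :
    ∃ T ⊆ U, ∃ α m : ℝ, 0 ≤ α ∧ 0 ≤ m ∧ T.card ≤ q ∧ (U.Nonempty → T.Nonempty) ∧
      (∀ i ∈ U \ T, a i ≤ α) ∧
      Real.sqrt q * α ≤ Real.sqrt (∑ i ∈ T, a i ^ 2) ∧
      Real.sqrt (∑ i ∈ T, a i ^ 2) ≤ Real.sqrt q * m ∧
      m + (q - 1) * α ≤ ∑ i ∈ T, a i ∧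
      ∀ β : ℝ, 0 ≤ β → (∀ i ∈ U, a i ≤ β) → m ≤ β := by
  have key : ∀ (T : Finset ι) (m : ℝ), 0 ≤ m → T.card ≤ q → (∀ i ∈ T, a i ≤ m) →
      Real.sqrt (∑ i ∈ T, a i ^ 2) ≤ Real.sqrt q * m := by
    intro T m hm hT h
    rw [← Real.sqrt_sq hm, ← Real.sqrt_mul (Nat.cast_nonneg q)]
    apply Real.sqrt_le_sqrt
    calc ∑ i ∈ T, a i ^ 2 ≤ ∑ _i ∈ T, m ^ 2 :=
          Finset.sum_le_sum fun i hi => pow_le_pow_left₀ (ha i) (h i hi) 2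
      _ = T.card * m ^ 2 := by simp
      _ ≤ q * m ^ 2 := by gcongr
  by_cases hU : U.card ≤ q
  · rcases U.eq_empty_or_nonempty with rfl | hne
    · exact ⟨∅, by simp, 0, 0, by simp⟩
    · obtain ⟨p, hp, hpmax⟩ := Finset.exists_max_image U a hne
      refine ⟨U, subset_rfl, 0, a p, le_rfl, ha p, hU, id, by simp, by simp,
        key U _ (ha p) hU hpmax, ?_, fun β _ h => h p hp⟩
      simpa using Finset.single_le_sum (fun i _ => ha i) hp
  · obtain ⟨T, hTU, hTc, hT⟩ := exists_top_subset a U q (by omega)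
    have hTne : T.Nonempty := by rw [← Finset.card_pos]; omega
    obtain ⟨p, hp, hpmax⟩ := Finset.exists_max_image T a hTne
    obtain ⟨r, hr, hrmin⟩ := Finset.exists_min_image T a hTne
    refine ⟨T, hTU, a r, a p, ha r, ha p, hTc.le, fun _ => hTne, fun j hj => hT r hr j hj, ?_,
      key T _ (ha p) hTc.le hpmax, ?_, fun β _ h => h p (hTU hp)⟩
    · rw [← Real.sqrt_sq (ha r), ← Real.sqrt_mul (Nat.cast_nonneg q)]
      apply Real.sqrt_le_sqrt
      calc (q : ℝ) * a r ^ 2 = ∑ _i ∈ T, a r ^ 2 := by simp [hTc]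
        _ ≤ ∑ i ∈ T, a i ^ 2 :=
          Finset.sum_le_sum fun i hi => pow_le_pow_left₀ (ha r) (hrmin i hi) 2
    · rw [← Finset.add_sum_erase T a hp]
      have : ∑ _i ∈ T.erase p, a r ≤ ∑ i ∈ T.erase p, a i :=
        Finset.sum_le_sum fun i hi => hrmin i (Finset.mem_of_mem_erase hi)
      rw [Finset.sum_const, Finset.card_erase_of_mem hp, hTc, nsmul_eq_mul,
        Nat.cast_sub hq, Nat.cast_one] at this
      linarith

/-- A bound by `C` times the `ℓ₂`-norm on blocks of at most `q` indices yields a bound by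
`C / √q` times an `ℓ₁`-type quantity on arbitrary index sets. -/
lemma abs_sum_le_of_block_bound (a : ι → ℝ) (ha : ∀ i, 0 ≤ a i) (q : ℕ) (hq : 1 ≤ q)
    (C : ℝ) (hC : 0 ≤ C) (v : ι → ℝ) (U : Finset ι)
    (hv : ∀ T ⊆ U, T.card ≤ q → |∑ i ∈ T, v i| ≤ C * Real.sqrt (∑ i ∈ T, a i ^ 2))
    (β : ℝ) (hβ : 0 ≤ β) (hUβ : ∀ i ∈ U, a i ≤ β) :
    |∑ i ∈ U, v i| ≤ C * (((q - 1) * β + ∑ i ∈ U, a i) / Real.sqrt q) := by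
  have hq1 : (1 : ℝ) ≤ q := by exact_mod_cast hq
  have hsq : 0 < Real.sqrt q := Real.sqrt_pos.2 (by linarith)
  induction hn : U.card using Nat.strong_induction_on generalizing U β with
  | _ n ih =>
    rcases U.eq_empty_or_nonempty with rfl | hne
    · have : 0 ≤ ((q : ℝ) - 1) * β := mul_nonneg (by linarith) hβ
      simp only [Finset.sum_empty, abs_zero, add_zero]
      positivity
    obtain ⟨T, hTU, α, m, hα, hm, hTc, hTne, hTα, -, hTm, hsum, hmβ⟩ :=
      exists_top_block a ha U q hq
    have hlt : (U \ T).card < n := by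
      rw [Finset.card_sdiff_of_subset hTU, ← hn]
      have := (hTne hne).card_pos
      have := Finset.card_le_card hTU
      omega
    have h2 := ih _ hlt (U \ T) (fun T' hT' => hv T' (hT'.trans Finset.sdiff_subset)) α hα hTα rfl
    have h1 := hv T hTU hTc
    have e1 := Finset.sum_sdiff (f := v) hTU
    have e2 := Finset.sum_sdiff (f := a) hTU
    have hmβ' := hmβ β hβ hUβ
    rw [← e1]
    calc |∑ i ∈ U \ T, v i + ∑ i ∈ T, v i| ≤ |∑ i ∈ U \ T, v i| + |∑ i ∈ T, v i| := abs_add_le _ _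
      _ ≤ C * (((q - 1) * α + ∑ i ∈ U \ T, a i) / Real.sqrt q) + C * (Real.sqrt q * m) := by
        gcongr
        exact h1.trans (by gcongr)
      _ = C * (((q - 1) * α + ∑ i ∈ U \ T, a i + q * m) / Real.sqrt q) := by
        rw [← mul_add]
        congr 1
        field_simp
        rw [Real.sq_sqrt (by linarith)]
      _ ≤ _ := by
        gcongr C * (?_ / _)
        have : ((q : ℝ) - 1) * m ≤ (q - 1) * β := mul_le_mul_of_nonneg_left hmβ' (by linarith)
        linarith

end SelectionOfLargestTerms

section ErrorBound

variable {b t S e s δ d D u w H : ℝ}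

/-- The error bound when the tail `t + S` is dominated by the head `b`. -/
lemma error_bound_of_tail_le (hb : 0 ≤ b) (ht : 0 ≤ t) (he : 0 ≤ e) (hs : 0 ≤ s)
    (hδ : 0 ≤ δ) (hd : 0 ≤ d) (hDd : D = Real.sqrt 2 * d) (hw : w = 1 - (1 + D) * δ) (hwpos : 0 < w)
    (hhead : (1 - δ) * b ≤ e + δ * (t + S)) (hblock : (1 - δ) * t ≤ e + δ * (b + S))
    (hH : H ^ 2 ≤ b ^ 2 + t ^ 2 + t * S) (hS : t + S ≤ D * b + s) :
    H * w ≤ (1 + d) * (e + Real.sqrt 2 * δ * s) + w * s := by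
  have h2 : Real.sqrt 2 ^ 2 = 2 := Real.sq_sqrt (by norm_num)
  have h2p : 0 ≤ Real.sqrt 2 := Real.sqrt_nonneg 2
  have h21 : 1 ≤ Real.sqrt 2 := by nlinarith
  have h22 : Real.sqrt 2 ≤ 2 := by nlinarith
  have hD : 0 ≤ D := by rw [hDd]; positivity
  have hD2 : D ≤ 2 * d := by rw [hDd]; gcongr
  set E := e + δ * s with hE
  have hE0 : 0 ≤ E := by positivity
  have hbw : b * w ≤ E := by
    have := mul_le_mul_of_nonneg_left hS hδ
    rw [hw]; linarith
  have htE : t ≤ E + (1 - w) * b := by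
    have := mul_le_mul_of_nonneg_left hS hδ
    rw [hw]; linarith
  have htw : t * w ≤ E := by
    have hw1 : 0 ≤ 1 - w := by rw [hw]; ring_nf; positivity
    have h3 := mul_le_mul_of_nonneg_right htE hwpos.le
    have h4 := mul_le_mul_of_nonneg_left hbw hw1
    linarith
  have hEE : E ≤ e + Real.sqrt 2 * δ * s := by
    have : 1 * (δ * s) ≤ Real.sqrt 2 * (δ * s) := by gcongr
    rw [hE]; linarith
  have hle : (1 + d) * E + w * s ≤ (1 + d) * (e + Real.sqrt 2 * δ * s) + w * s := by gcongr
  refine le_trans (abs_le_of_sq_le_sq' ?_ (by positivity)).2 hle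
  have hb2 : (b * w) ^ 2 ≤ E ^ 2 := pow_le_pow_left₀ (by positivity) hbw 2
  have hbt : (t * w) * (b * w) ≤ E * E := mul_le_mul htw hbw (by positivity) hE0
  have hts : (t * w) * (w * s) ≤ E * (w * s) := by gcongr
  have hH2 : H ^ 2 ≤ b ^ 2 + t * (D * b + s) := by
    have := mul_le_mul_of_nonneg_left hS ht
    linarith
  have hDE : D * ((t * w) * (b * w)) ≤ 2 * d * (E * E) := by gcongr
  have hdE : 0 ≤ d ^ 2 * E ^ 2 := by positivity
  have hdEs : 0 ≤ (1 + 2 * d) * E * (w * s) := by positivity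
  have hws : 0 ≤ (w * s) ^ 2 := by positivity
  calc (H * w) ^ 2 = H ^ 2 * w ^ 2 := by ring
    _ ≤ (b ^ 2 + t * (D * b + s)) * w ^ 2 := by gcongr
    _ = (b * w) ^ 2 + D * ((t * w) * (b * w)) + (t * w) * (w * s) := by ring
    _ ≤ E ^ 2 + 2 * d * (E * E) + E * (w * s) := by linarith
    _ ≤ ((1 + d) * E + w * s) ^ 2 := by linarith

/-- The error bound when the contribution `S` of the far tail is small compared with `D * b`. -/
lemma error_bound_of_far_tail_le (hb : 0 ≤ b) (ht : 0 ≤ t) (hs : 0 ≤ s) (he : 0 ≤ e)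
    (hδ : 0 ≤ δ) (hd : 0 ≤ d) (hDd : D = Real.sqrt 2 * d) (hw : w = 1 - (1 + D) * δ) (hwpos : 0 < w)
    (hu : 0 ≤ u) (hu2 : u ^ 2 = b ^ 2 + t ^ 2)
    (hhead : (1 - δ) * u ^ 2 ≤ u * e + δ * ((b + t) * S))
    (hH : H ^ 2 ≤ b ^ 2 + t ^ 2 + t * S) (hS : S ≤ 0.82 * (D * b) + s) :
    H * w ≤ (1 + d) * (e + Real.sqrt 2 * δ * s) + w * s := by
  have h2 : Real.sqrt 2 ^ 2 = 2 := Real.sq_sqrt (by norm_num)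
  have h2p : 0 ≤ Real.sqrt 2 := Real.sqrt_nonneg 2
  have h22 : Real.sqrt 2 ≤ 2 := by nlinarith
  have hD : 0 ≤ D := by rw [hDd]; positivity
  have hD2 : D ≤ 2 * d := by rw [hDd]; gcongr
  have hbt : b + t ≤ Real.sqrt 2 * u := by
    apply (abs_le_of_sq_le_sq' _ (by positivity)).2
    rw [mul_pow, h2, hu2]
    nlinarith [sq_nonneg (b - t)]
  have hbb : 0.82 * ((b + t) * b) ≤ u ^ 2 := by
    rw [hu2]; nlinarith [sq_nonneg (t - 0.41 * b), sq_nonneg b]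
  have hmain : (1 - δ) * u ^ 2 ≤ u * e + δ * (D * u ^ 2 + Real.sqrt 2 * u * s) := by
    refine hhead.trans ?_
    gcongr
    calc (b + t) * S ≤ (b + t) * (0.82 * (D * b) + s) := by gcongr
      _ = D * (0.82 * ((b + t) * b)) + (b + t) * s := by ring
      _ ≤ D * u ^ 2 + Real.sqrt 2 * u * s := by gcongr
  have huw : u * w ≤ e + Real.sqrt 2 * δ * s := by
    rcases hu.eq_or_lt with h0 | hpos
    · rw [← h0, zero_mul]; positivity
    · refine le_of_mul_le_mul_left ?_ hpos
      rw [hw]; linarith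
  have hHu : H ≤ (1 + d) * u + s := by
    apply (abs_le_of_sq_le_sq' _ (by positivity)).2
    have htu : t ≤ u := by
      apply (abs_le_of_sq_le_sq' _ hu).2
      nlinarith [sq_nonneg b]
    have htb : t * b ≤ u ^ 2 := by
      rw [hu2]; nlinarith [sq_nonneg (t - b), sq_nonneg b, sq_nonneg t]
    have h5 : D * (0.82 * (t * b)) ≤ 2 * d * (1 * u ^ 2) := by
      gcongr
      have : 0 ≤ t * b := by positivity
      linarith
    calc H ^ 2 ≤ b ^ 2 + t ^ 2 + t * S := hH
      _ ≤ b ^ 2 + t ^ 2 + t * (0.82 * (D * b) + s) := by gcongr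
      _ = u ^ 2 + D * (0.82 * (t * b)) + t * s := by rw [hu2]; ring
      _ ≤ u ^ 2 + 2 * d * (1 * u ^ 2) + u * s := by gcongr
      _ ≤ ((1 + d) * u + s) ^ 2 := by
        have : 0 ≤ d ^ 2 * u ^ 2 + (1 + 2 * d) * (u * s) + s ^ 2 := by positivity
        linarith
  calc H * w ≤ ((1 + d) * u + s) * w := by gcongr
    _ = (1 + d) * (u * w) + w * s := by ring
    _ ≤ _ := by gcongr

/-- Either the whole tail is dominated by the head, or the far tail is small. -/
lemma tail_le_or_far_tail_le {q : ℕ} {m : ℝ} (hq : 1 ≤ q) (hb : 0 ≤ b) (hm : 0 ≤ m) (hs : 0 ≤ s)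
    (hd : 0 ≤ d) (hDd : D = Real.sqrt 2 * d) (htm : t ≤ Real.sqrt q * m)
    (hS : Real.sqrt q * S ≤ Real.sqrt (q + 1) * d * b + s - m) :
    t + S ≤ D * b + s ∨ S ≤ 0.82 * (D * b) + s := by
  have hq1 : (1 : ℝ) ≤ q := by exact_mod_cast hq
  have hdb : 0 ≤ d * b := by positivity
  have h2 : Real.sqrt 2 ^ 2 = 2 := Real.sq_sqrt (by norm_num)
  have h2p : 0 ≤ Real.sqrt 2 := Real.sqrt_nonneg 2
  obtain rfl | rfl | h3 : q = 1 ∨ q = 2 ∨ 3 ≤ q := by omega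
  · left
    norm_num at hS htm
    rw [hDd]; linarith
  · norm_num at hS htm
    have h3 : Real.sqrt 3 ^ 2 = 3 := Real.sq_sqrt (by norm_num)
    have h3p : 0 ≤ Real.sqrt 3 := Real.sqrt_nonneg 3
    by_contra! hcon
    obtain ⟨hc1, hc2⟩ := hcon
    rw [hDd] at hc1 hc2
    have h2l : 1.414 ≤ Real.sqrt 2 := Real.le_sqrt_of_sq_le (by norm_num)
    have h3u : Real.sqrt 3 ≤ 1.733 := Real.sqrt_le_iff.2 ⟨by norm_num, by norm_num⟩
    have h6 : Real.sqrt 2 * t ≤ 2 * m := by nlinarith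
    have hc1' := mul_lt_mul_of_pos_left hc1 (show 0 < Real.sqrt 2 by linarith)
    have hc2' := mul_lt_mul_of_pos_left hc2 (show 0 < Real.sqrt 2 by linarith)
    have e1 : Real.sqrt 2 * (Real.sqrt 2 * d * b + s) = 2 * (d * b) + Real.sqrt 2 * s := by
      linear_combination (d * b) * h2
    have e2 : Real.sqrt 2 * (0.82 * (Real.sqrt 2 * d * b) + s)
        = 1.64 * (d * b) + Real.sqrt 2 * s := by
      linear_combination 0.82 * (d * b) * h2
    have h7 : Real.sqrt 3 * (d * b) ≤ 1.733 * (d * b) := by gcongr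
    have h8 : 1.414 * s ≤ Real.sqrt 2 * s := by gcongr
    nlinarith
  · right
    have hq3 : (3 : ℝ) ≤ q := by exact_mod_cast h3
    have hsq : 1 ≤ Real.sqrt q := Real.one_le_sqrt.2 hq1
    have hk : Real.sqrt (q + 1) ≤ Real.sqrt q * (0.82 * Real.sqrt 2) := by
      rw [Real.sqrt_le_left (by positivity), mul_pow, mul_pow, h2, Real.sq_sqrt (by linarith)]
      linarith
    refine le_of_mul_le_mul_left ?_ (show 0 < Real.sqrt q by linarith)
    have h4 := mul_le_mul_of_nonneg_right hk hdb
    have h5 : 1 * s ≤ Real.sqrt q * s := by gcongr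
    rw [hDd]; linarith

end ErrorBound

section Vectors

variable {m n g : ℕ}

lemma norm2_nonneg (x : Fin n → ℝ) : 0 ≤ norm2 x := Real.sqrt_nonneg _

lemma norm2_eq_norm (x : Fin n → ℝ) : norm2 x = ‖WithLp.toLp 2 x‖ := by
  simp [norm2, EuclideanSpace.norm_eq]

lemma norm2_sq (x : Fin n → ℝ) : norm2 x ^ 2 = ∑ i, x i ^ 2 :=
  Real.sq_sqrt (Finset.sum_nonneg fun _ _ => sq_nonneg _)

lemma norm2_sq_eq_dotProduct (x : Fin n → ℝ) : norm2 x ^ 2 = x ⬝ᵥ x := by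
  rw [norm2_sq]
  simp only [dotProduct, sq]

lemma norm2_add_le (x y : Fin n → ℝ) : norm2 (x + y) ≤ norm2 x + norm2 y := by
  simpa only [norm2_eq_norm, WithLp.toLp_add] using norm_add_le _ _

lemma norm2_sub_le (x y : Fin n → ℝ) : norm2 (x - y) ≤ norm2 x + norm2 y := by
  simpa only [norm2_eq_norm, WithLp.toLp_sub] using norm_sub_le _ _

lemma norm1_add_le (x y : Fin n → ℝ) : norm1 (x + y) ≤ norm1 x + norm1 y := by
  simp only [norm1, ← Finset.sum_add_distrib]
  exact Finset.sum_le_sum fun i _ => abs_add_le _ _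

lemma norm1_sub_le (x y : Fin n → ℝ) : norm1 (x - y) ≤ norm1 x + norm1 y := by
  simp only [norm1, ← Finset.sum_add_distrib]
  exact Finset.sum_le_sum fun i _ => abs_sub _ _

lemma norm1_nonneg (x : Fin n → ℝ) : 0 ≤ norm1 x := Finset.sum_nonneg fun _ _ => abs_nonneg _

lemma norm2_le_norm1 (x : Fin n → ℝ) : norm2 x ≤ norm1 x := by
  refine Real.sqrt_le_iff.2 ⟨norm1_nonneg x, ?_⟩
  have := Finset.sum_sq_le_sq_sum_of_nonneg (s := Finset.univ) (f := fun i => |x i|)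
    fun i _ => abs_nonneg _
  simpa only [sq_abs, norm1] using this

lemma abs_dotProduct_le (x y : Fin n → ℝ) : |x ⬝ᵥ y| ≤ norm2 x * norm2 y := by
  apply abs_le_of_sq_le_sq _ (mul_nonneg (norm2_nonneg x) (norm2_nonneg y))
  rw [mul_pow, norm2_sq, norm2_sq]
  exact Finset.sum_mul_sq_le_sq_mul_sq _ _ _

lemma restr_add (Λ : Finset (Fin n)) (x y : Fin n → ℝ) :
    restr Λ (x + y) = restr Λ x + restr Λ y := by
  ext i; by_cases h : i ∈ Λ <;> simp [restr, h]

lemma restr_sub (Λ : Finset (Fin n)) (x y : Fin n → ℝ) :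
    restr Λ (x - y) = restr Λ x - restr Λ y := by
  ext i; by_cases h : i ∈ Λ <;> simp [restr, h]

lemma norm2_restr_sq (Λ : Finset (Fin n)) (x : Fin n → ℝ) :
    norm2 (restr Λ x) ^ 2 = ∑ i ∈ Λ, x i ^ 2 := by
  simp [norm2_sq, restr, Finset.sum_ite_mem]

lemma norm1_restr (Λ : Finset (Fin n)) (x : Fin n → ℝ) :
    norm1 (restr Λ x) = ∑ i ∈ Λ, |x i| := by
  simp [norm1, restr, apply_ite abs, Finset.sum_ite_mem]

lemma norm1_restr_le (Λ : Finset (Fin n)) (x : Fin n → ℝ) :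
    norm1 (restr Λ x) ≤ Real.sqrt Λ.card * norm2 (restr Λ x) := by
  apply (abs_le_of_sq_le_sq' _ (mul_nonneg (Real.sqrt_nonneg _) (norm2_nonneg _))).2
  rw [mul_pow, Real.sq_sqrt (Nat.cast_nonneg _), norm2_restr_sq, norm1_restr]
  simpa only [sq_abs] using sq_sum_le_card_mul_sum_sq (s := Λ) (f := fun i => |x i|)

lemma support_restr_subset (Λ : Finset (Fin n)) (x : Fin n → ℝ) :
    Function.support (restr Λ x) ⊆ ↑Λ := by
  intro i hi
  by_contra h
  exact hi (if_neg h)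

lemma dotProduct_restr_of_disjoint {Λ Γ : Finset (Fin n)} (h : Disjoint Λ Γ) (x y : Fin n → ℝ) :
    restr Λ x ⬝ᵥ restr Γ y = 0 := by
  refine Finset.sum_eq_zero fun i _ => ?_
  by_cases hi : i ∈ Λ
  · simp [restr, Finset.disjoint_left.1 h hi]
  · simp [restr, hi]

lemma restr_union_of_disjoint {Λ Γ : Finset (Fin n)} (h : Disjoint Λ Γ) (x : Fin n → ℝ) :
    restr (Λ ∪ Γ) x = restr Λ x + restr Γ x := by
  ext i
  by_cases hi : i ∈ Λ
  · simp [restr, hi, Finset.disjoint_left.1 h hi]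
  · simp [restr, hi]

/-- The polarized form of the group restricted isometry property. -/
lemma GRIP.abs_dotProduct_mulVec_le {G : Fin g → Finset (Fin n)} {A : Matrix (Fin m) (Fin n) ℝ}
    {t : ℕ} {δ : ℝ} (hA : GRIP G A t δ) (hδ : 0 ≤ δ) {Λ : Finset (Fin n)} (hΛ : GkS G t Λ)
    {u v : Fin n → ℝ} (hu : Function.support u ⊆ ↑Λ) (hv : Function.support v ⊆ ↑Λ)
    (huv : u ⬝ᵥ v = 0) :
    |A.mulVec u ⬝ᵥ A.mulVec v| ≤ δ * norm2 u * norm2 v := by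
  have hsupp : ∀ r : ℝ, Function.support (u + r • v) ⊆ ↑Λ := by
    intro r i hi
    by_contra h
    have h1 : u i = 0 := by_contra fun h' => h (hu h')
    have h2 : v i = 0 := by_contra fun h' => h (hv h')
    exact hi (by simp [h1, h2])
  have hN : ∀ r : ℝ, norm2 (u + r • v) ^ 2 = norm2 u ^ 2 + r ^ 2 * norm2 v ^ 2 := by
    intro r
    simp only [norm2_sq_eq_dotProduct, add_dotProduct, dotProduct_add, smul_dotProduct,
      dotProduct_smul, huv, dotProduct_comm v u, smul_eq_mul]
    ring
  have hM : ∀ r : ℝ, norm2 (A.mulVec (u + r • v)) ^ 2 = norm2 (A.mulVec u) ^ 2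
      + 2 * r * (A.mulVec u ⬝ᵥ A.mulVec v) + r ^ 2 * norm2 (A.mulVec v) ^ 2 := by
    intro r
    simp only [norm2_sq_eq_dotProduct, Matrix.mulVec_add, Matrix.mulVec_smul, add_dotProduct,
      dotProduct_add, smul_dotProduct, dotProduct_smul,
      dotProduct_comm (A.mulVec v) (A.mulVec u), smul_eq_mul]
    ring
  have hq : ∀ r : ℝ, 0 ≤ (δ * norm2 v ^ 2) * (r * r) + (-2 * (A.mulVec u ⬝ᵥ A.mulVec v)) * r
      + δ * norm2 u ^ 2 := by
    intro r
    have h1 := (hA _ ⟨Λ, hΛ, hsupp r⟩).2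
    have h2 := (hA _ ⟨Λ, hΛ, hsupp (-r)⟩).1
    rw [hN, hM] at h1 h2
    linarith
  have hd := discrim_le_zero hq
  rw [discrim] at hd
  apply abs_le_of_sq_le_sq _
    (mul_nonneg (mul_nonneg hδ (norm2_nonneg u)) (norm2_nonneg v))
  linarith

end Vectors

section Groups

variable {n g : ℕ} {G : Fin g → Finset (Fin n)}

lemma disjoint_biUnion_of_disjoint (hdisj : ∀ i j : Fin g, i ≠ j → Disjoint (G i) (G j))
    {S T : Finset (Fin g)} (h : Disjoint S T) : Disjoint (S.biUnion G) (T.biUnion G) := by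
  rw [Finset.disjoint_biUnion_left]
  intro i hi
  rw [Finset.disjoint_biUnion_right]
  intro j hj
  exact hdisj i j fun hij => Finset.disjoint_left.1 h hi (hij ▸ hj)

lemma restr_biUnion (hdisj : ∀ i j : Fin g, i ≠ j → Disjoint (G i) (G j))
    (T : Finset (Fin g)) (x : Fin n → ℝ) :
    restr (T.biUnion G) x = ∑ i ∈ T, restr (G i) x := by
  induction T using Finset.induction_on with
  | empty => ext i; simp [restr]
  | insert j T hj ih =>
    rw [Finset.sum_insert hj, ← ih, Finset.biUnion_insert, restr_union_of_disjoint]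
    simpa using disjoint_biUnion_of_disjoint hdisj (Finset.disjoint_singleton_left.2 hj)

lemma norm2_restr_biUnion (hdisj : ∀ i j : Fin g, i ≠ j → Disjoint (G i) (G j))
    (T : Finset (Fin g)) (x : Fin n → ℝ) :
    norm2 (restr (T.biUnion G) x) = Real.sqrt (∑ i ∈ T, norm2 (restr (G i) x) ^ 2) := by
  rw [← Real.sqrt_sq (norm2_nonneg _), norm2_restr_sq,
    Finset.sum_biUnion fun i _ j _ hij => hdisj i j hij]
  simp only [norm2_restr_sq]

lemma norm1_restr_biUnion (hdisj : ∀ i j : Fin g, i ≠ j → Disjoint (G i) (G j))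
    (T : Finset (Fin g)) (x : Fin n → ℝ) :
    norm1 (restr (T.biUnion G) x) = ∑ i ∈ T, norm1 (restr (G i) x) := by
  rw [norm1_restr, Finset.sum_biUnion fun i _ j _ hij => hdisj i j hij]
  simp only [norm1_restr]

lemma card_mul_le_card_biUnion (hdisj : ∀ i j : Fin g, i ≠ j → Disjoint (G i) (G j)) {l : ℕ}
    (hl : ∀ i, l ≤ (G i).card) (T : Finset (Fin g)) : T.card * l ≤ (T.biUnion G).card := by
  rw [Finset.card_biUnion fun i _ j _ hij => hdisj i j hij]
  simpa using Finset.card_nsmul_le_sum T (fun i => (G i).card) l fun i _ => hl i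

/-- The contribution of a single group to the sparse group LASSO norm. -/
def groupTerm (μ : ℝ) (Λ : Finset (Fin n)) (x : Fin n → ℝ) : ℝ :=
  (1 - μ) * norm1 (restr Λ x) + μ * norm2 (restr Λ x)

variable {μ : ℝ}

lemma groupTerm_nonneg (hμ0 : 0 ≤ μ) (hμ1 : μ ≤ 1) (Λ : Finset (Fin n)) (x : Fin n → ℝ) :
    0 ≤ groupTerm μ Λ x :=
  add_nonneg (mul_nonneg (sub_nonneg.2 hμ1) (norm1_nonneg _)) (mul_nonneg hμ0 (norm2_nonneg _))

lemma norm2_restr_le_groupTerm (hμ1 : μ ≤ 1) (Λ : Finset (Fin n)) (x : Fin n → ℝ) :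
    norm2 (restr Λ x) ≤ groupTerm μ Λ x := by
  have := mul_le_mul_of_nonneg_left (norm2_le_norm1 (restr Λ x)) (sub_nonneg.2 hμ1)
  rw [groupTerm]; linarith

lemma groupTerm_add_le (hμ0 : 0 ≤ μ) (hμ1 : μ ≤ 1) (Λ : Finset (Fin n)) (x y : Fin n → ℝ) :
    groupTerm μ Λ (x + y) ≤ groupTerm μ Λ x + groupTerm μ Λ y := by
  have h1 := mul_le_mul_of_nonneg_left (norm1_add_le (restr Λ x) (restr Λ y)) (sub_nonneg.2 hμ1)
  have h2 := mul_le_mul_of_nonneg_left (norm2_add_le (restr Λ x) (restr Λ y)) hμ0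
  simp only [groupTerm, restr_add]; linarith

lemma groupTerm_sub_le (hμ0 : 0 ≤ μ) (hμ1 : μ ≤ 1) (Λ : Finset (Fin n)) (x y : Fin n → ℝ) :
    groupTerm μ Λ (x - y) ≤ groupTerm μ Λ x + groupTerm μ Λ y := by
  have h1 := mul_le_mul_of_nonneg_left (norm1_sub_le (restr Λ x) (restr Λ y)) (sub_nonneg.2 hμ1)
  have h2 := mul_le_mul_of_nonneg_left (norm2_sub_le (restr Λ x) (restr Λ y)) hμ0
  simp only [groupTerm, restr_sub]; linarith

/-- The sparse group LASSO norm of the residual of a group-sparse restriction. -/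
lemma sum_groupTerm_sub_restr (hdisj : ∀ i j : Fin g, i ≠ j → Disjoint (G i) (G j))
    (S : Finset (Fin g)) (x : Fin n → ℝ) :
    ∑ i, groupTerm μ (G i) (x - restr (S.biUnion G) x) = ∑ i ∈ Sᶜ, groupTerm μ (G i) x := by
  rw [← Finset.sum_add_sum_compl S]
  have h1 : ∑ i ∈ S, groupTerm μ (G i) (x - restr (S.biUnion G) x) = 0 := by
    refine Finset.sum_eq_zero fun i hi => ?_
    have : restr (G i) (x - restr (S.biUnion G) x) = 0 := by
      ext r
      by_cases hr : r ∈ G i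
      · have : r ∈ S.biUnion G := Finset.mem_biUnion.2 ⟨i, hi, hr⟩
        simp only [restr, Pi.sub_apply, if_pos hr, if_pos this, sub_self, Pi.zero_apply]
      · simp [restr, hr]
    rw [groupTerm, this]
    simp [norm1, norm2]
  rw [h1, zero_add]
  refine Finset.sum_congr rfl fun i hi => ?_
  have : restr (G i) (x - restr (S.biUnion G) x) = restr (G i) x := by
    ext r
    by_cases hr : r ∈ G i
    · have : r ∉ S.biUnion G := by
        have := disjoint_biUnion_of_disjoint hdisj
          (Finset.disjoint_singleton_left.2 (Finset.mem_compl.1 hi))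
        rw [Finset.singleton_biUnion] at this
        exact Finset.disjoint_left.1 this hr
      simp only [restr, Pi.sub_apply, if_pos hr, if_neg this, sub_zero]
    · simp [restr, hr]
  simp only [groupTerm, this]

/-- The cone condition satisfied by the error of a minimizer. -/
lemma sum_compl_groupTerm_le (hμ0 : 0 ≤ μ) (hμ1 : μ ≤ 1) (S : Finset (Fin g)) (x z : Fin n → ℝ)
    (h : ∑ i, groupTerm μ (G i) z ≤ ∑ i, groupTerm μ (G i) x) :
    ∑ i ∈ Sᶜ, groupTerm μ (G i) (z - x)
      ≤ ∑ i ∈ S, groupTerm μ (G i) (z - x) + 2 * ∑ i ∈ Sᶜ, groupTerm μ (G i) x := by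
  rw [← Finset.sum_add_sum_compl S, ← Finset.sum_add_sum_compl S] at h
  have h1 : ∑ i ∈ S, groupTerm μ (G i) x
      ≤ ∑ i ∈ S, groupTerm μ (G i) z + ∑ i ∈ S, groupTerm μ (G i) (z - x) := by
    rw [← Finset.sum_add_distrib]
    refine Finset.sum_le_sum fun i _ => ?_
    simpa using groupTerm_sub_le hμ0 hμ1 (G i) z (z - x)
  have h2 : ∑ i ∈ Sᶜ, groupTerm μ (G i) (z - x)
      ≤ ∑ i ∈ Sᶜ, groupTerm μ (G i) z + ∑ i ∈ Sᶜ, groupTerm μ (G i) x := by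
    rw [← Finset.sum_add_distrib]
    exact Finset.sum_le_sum fun i _ => groupTerm_sub_le hμ0 hμ1 (G i) z x
  linarith

lemma sum_groupTerm_le (hdisj : ∀ i j : Fin g, i ≠ j → Disjoint (G i) (G j))
    (hμ0 : 0 ≤ μ) (hμ1 : μ ≤ 1) (S : Finset (Fin g)) (x : Fin n → ℝ) :
    ∑ i ∈ S, groupTerm μ (G i) x ≤
      ((1 - μ) * Real.sqrt (S.biUnion G).card + μ * Real.sqrt S.card)
        * norm2 (restr (S.biUnion G) x) := by
  have h1 := mul_le_mul_of_nonneg_left (norm1_restr_le (S.biUnion G) x) (sub_nonneg.2 hμ1)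
  have h2 : ∑ i ∈ S, norm2 (restr (G i) x) ≤ Real.sqrt S.card * norm2 (restr (S.biUnion G) x) := by
    rw [norm2_restr_biUnion hdisj, ← Real.sqrt_mul (Nat.cast_nonneg _)]
    exact Real.le_sqrt_of_sq_le sq_sum_le_card_mul_sum_sq
  have h3 := mul_le_mul_of_nonneg_left h2 hμ0
  rw [norm1_restr_biUnion hdisj] at h1
  simp only [groupTerm, Finset.sum_add_distrib, ← Finset.mul_sum]
  linarith

end Groups

section Recovery

variable {m n g k : ℕ} {G : Fin g → Finset (Fin n)}

lemma card_biUnion_le_mul {l : ℕ} (hl : ∀ i, (G i).card ≤ l) (T : Finset (Fin g)) :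
    (T.biUnion G).card ≤ T.card * l :=
  Finset.card_biUnion_le_card_mul T G l fun i _ => hl i

/-- An error bound for a vector whose group norms outside `S` are controlled by its norm on `S`. -/
lemma GRIP.norm2_mul_le (hdisj : ∀ i j : Fin g, i ≠ j → Disjoint (G i) (G j))
    (hcover : Finset.univ.biUnion G = (Finset.univ : Finset (Fin n)))
    {l q : ℕ} (hl : ∀ i, (G i).card ≤ l) (hq : 1 ≤ q) (hqk : q * l ≤ k)
    {A : Matrix (Fin m) (Fin n) ℝ} {δ : ℝ} (hδ : 0 ≤ δ) (hA : GRIP G A (2 * k) δ)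
    {S : Finset (Fin g)} (hS : (S.biUnion G).card ≤ k) {h : Fin n → ℝ} {d e s : ℝ}
    (hd : 0 ≤ d) (he : 0 ≤ e) (hs : 0 ≤ s) (hw : 0 < 1 - (1 + Real.sqrt 2 * d) * δ)
    (hcone : ∑ i ∈ Sᶜ, norm2 (restr (G i) h)
      ≤ Real.sqrt (q + 1) * d * norm2 (restr (S.biUnion G) h) + s)
    (hnoise : Real.sqrt (1 + δ) * norm2 (A.mulVec h) ≤ e) :
    norm2 h * (1 - (1 + Real.sqrt 2 * d) * δ)
      ≤ (1 + d) * (e + Real.sqrt 2 * δ * s) + (1 - (1 + Real.sqrt 2 * d) * δ) * s := by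
  set a : Fin g → ℝ := fun i => norm2 (restr (G i) h)
  have ha : ∀ i, 0 ≤ a i := fun i => norm2_nonneg _
  have hsq : 1 ≤ Real.sqrt q := Real.one_le_sqrt.2 (by exact_mod_cast hq)
  have hq1 : (0 : ℝ) ≤ q - 1 := sub_nonneg.2 (by exact_mod_cast hq)
  obtain ⟨T, hTU, α, p, hα, hp, hTc, -, hTα, hαT, hTp, hTsum, -⟩ := exists_top_block a ha Sᶜ q hq
  set R := Sᶜ \ T with hR
  have hST : Disjoint S T := Finset.disjoint_right.2 fun i hi => Finset.mem_compl.1 (hTU hi)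
  have hSR : Disjoint S R := Finset.disjoint_right.2 fun i hi =>
    Finset.mem_compl.1 (Finset.mem_sdiff.1 hi).1
  have hTR : Disjoint T R := Finset.disjoint_sdiff
  have hcard : ∀ V : Finset (Fin g), V.card ≤ q → (V.biUnion G).card ≤ k := fun V hV =>
    (card_biUnion_le_mul hl V).trans ((Nat.mul_le_mul_right l hV).trans hqk)
  -- `proj V` is the part of `h` on the groups in `V`
  set proj : Finset (Fin g) → Fin n → ℝ := fun V => restr (V.biUnion G) h with hproj
  have hnorm : ∀ V, norm2 (proj V) = Real.sqrt (∑ i ∈ V, a i ^ 2) := fun V =>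
    norm2_restr_biUnion hdisj V h
  have hgks : ∀ V W : Finset (Fin g), (V.biUnion G).card ≤ k → (W.biUnion G).card ≤ k →
      GkS G (2 * k) ((V ∪ W).biUnion G) := by
    refine fun V W hV hW => ⟨⟨_, rfl⟩, ?_⟩
    rw [Finset.union_biUnion]
    exact (Finset.card_union_le _ _).trans (by omega)
  have hpair : ∀ V W : Finset (Fin g), (V.biUnion G).card ≤ k → (W.biUnion G).card ≤ k →
      Disjoint V W →
      |A.mulVec (proj V) ⬝ᵥ A.mulVec (proj W)| ≤ δ * norm2 (proj V) * norm2 (proj W) := by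
    intro V W hV hW hVW
    refine hA.abs_dotProduct_mulVec_le hδ (hgks V W hV hW) ?_ ?_
      (dotProduct_restr_of_disjoint (disjoint_biUnion_of_disjoint hdisj hVW) h h)
    · refine (support_restr_subset _ _).trans (Finset.coe_subset.2 ?_)
      exact Finset.biUnion_subset_biUnion_of_subset_left _ Finset.subset_union_left
    · refine (support_restr_subset _ _).trans (Finset.coe_subset.2 ?_)
      exact Finset.biUnion_subset_biUnion_of_subset_left _ Finset.subset_union_right
  set B : ℝ := ((q - 1) * α + ∑ i ∈ R, a i) / Real.sqrt q with hB
  have hRsum : 0 ≤ ∑ i ∈ R, a i := Finset.sum_nonneg fun i _ => ha i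
  have hBq : Real.sqrt q * B = (q - 1) * α + ∑ i ∈ R, a i := by
    rw [hB]; field_simp
  have htail : ∀ V : Finset (Fin g), (V.biUnion G).card ≤ k → Disjoint V R →
      |A.mulVec (proj V) ⬝ᵥ A.mulVec (proj R)| ≤ δ * norm2 (proj V) * B := by
    intro V hV hVR
    have hsum : ∀ W : Finset (Fin g), A.mulVec (proj V) ⬝ᵥ A.mulVec (proj W)
        = ∑ i ∈ W, A.mulVec (proj V) ⬝ᵥ A.mulVec (restr (G i) h) := by
      intro W
      simp only [hproj]
      rw [restr_biUnion hdisj W, ← dotProduct_sum]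
      congr 1
      exact map_sum A.mulVecLin _ _
    rw [hsum R]
    refine abs_sum_le_of_block_bound a ha q hq _ (mul_nonneg hδ (norm2_nonneg _)) _ R ?_ α hα hTα
    intro W hWR hW
    rw [← hsum W, ← hnorm]
    exact hpair V W hV (hcard W hW) (hVR.mono_right hWR)
  have hsplit : h = proj S + proj T + proj R := by
    have e1 : (S ∪ T) ∪ R = Finset.univ := by
      rw [Finset.union_assoc, Finset.union_sdiff_of_subset hTU, Finset.union_compl]
    have e2 : proj Finset.univ = h := by
      ext i; simp [hproj, hcover, restr]
    rw [← e2, ← e1]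
    simp only [hproj]
    rw [Finset.union_biUnion, restr_union_of_disjoint, Finset.union_biUnion,
      restr_union_of_disjoint]
    · exact disjoint_biUnion_of_disjoint hdisj hST
    · exact disjoint_biUnion_of_disjoint hdisj (Finset.disjoint_union_left.2 ⟨hSR, hTR⟩)
  have hAh : A.mulVec h = A.mulVec (proj S) + A.mulVec (proj T) + A.mulVec (proj R) := by
    rw [← Matrix.mulVec_add, ← Matrix.mulVec_add, ← hsplit]
  have hnormsq : ∀ V, norm2 (proj V) ^ 2 = ∑ i ∈ V, a i ^ 2 := fun V => by
    rw [hnorm, Real.sq_sqrt (Finset.sum_nonneg fun _ _ => sq_nonneg _)]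
  have hhsq : norm2 h ^ 2 = norm2 (proj S) ^ 2 + norm2 (proj T) ^ 2 + ∑ i ∈ R, a i ^ 2 := by
    rw [← hnormsq]
    nth_rewrite 1 [hsplit]
    have o1 : proj S ⬝ᵥ proj T = 0 :=
      dotProduct_restr_of_disjoint (disjoint_biUnion_of_disjoint hdisj hST) h h
    have o2 : proj S ⬝ᵥ proj R = 0 :=
      dotProduct_restr_of_disjoint (disjoint_biUnion_of_disjoint hdisj hSR) h h
    have o3 : proj T ⬝ᵥ proj R = 0 :=
      dotProduct_restr_of_disjoint (disjoint_biUnion_of_disjoint hdisj hTR) h h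
    simp only [norm2_sq_eq_dotProduct, add_dotProduct, dotProduct_add,
      dotProduct_comm (proj T) (proj S), dotProduct_comm (proj R) (proj S),
      dotProduct_comm (proj R) (proj T), o1, o2, o3]
    ring
  have hTk := hcard T hTc
  have hnoise' : ∀ z : Fin n → ℝ, (∃ Λ, GkS G (2 * k) Λ ∧ Function.support z ⊆ ↑Λ) →
      (1 - δ) * norm2 z ^ 2 ≤ A.mulVec z ⬝ᵥ A.mulVec z ∧
      A.mulVec z ⬝ᵥ A.mulVec h ≤ norm2 z * e := by
    intro z hz
    obtain ⟨h1, h2⟩ := hA z hz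
    refine ⟨norm2_sq_eq_dotProduct (A.mulVec z) ▸ h1, ?_⟩
    have h3 : norm2 (A.mulVec z) ≤ Real.sqrt (1 + δ) * norm2 z := by
      apply (abs_le_of_sq_le_sq' _ (mul_nonneg (Real.sqrt_nonneg _) (norm2_nonneg _))).2
      rwa [mul_pow, Real.sq_sqrt (by linarith)]
    calc A.mulVec z ⬝ᵥ A.mulVec h ≤ norm2 (A.mulVec z) * norm2 (A.mulVec h) :=
          (le_abs_self _).trans (abs_dotProduct_le _ _)
      _ ≤ Real.sqrt (1 + δ) * norm2 z * norm2 (A.mulVec h) := by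
        gcongr
        exact norm2_nonneg _
      _ = norm2 z * (Real.sqrt (1 + δ) * norm2 (A.mulVec h)) := by ring
      _ ≤ norm2 z * e := mul_le_mul_of_nonneg_left hnoise (norm2_nonneg _)
  have hgksS : GkS G (2 * k) (S.biUnion G) := ⟨⟨S, rfl⟩, by omega⟩
  have hgksT : GkS G (2 * k) (T.biUnion G) := ⟨⟨T, rfl⟩, by omega⟩
  obtain ⟨lowS, noiseS⟩ := hnoise' (proj S) ⟨_, hgksS, support_restr_subset _ _⟩
  obtain ⟨lowT, noiseT⟩ := hnoise' (proj T) ⟨_, hgksT, support_restr_subset _ _⟩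
  have hprojST : proj (S ∪ T) = proj S + proj T := by
    simp only [hproj]
    rw [Finset.union_biUnion,
      restr_union_of_disjoint (disjoint_biUnion_of_disjoint hdisj hST)]
  obtain ⟨lowST, noiseST⟩ := hnoise' (proj (S ∪ T)) ⟨_, hgks S T hS hTk, support_restr_subset _ _⟩
  have hunorm : norm2 (proj (S ∪ T)) ^ 2 = norm2 (proj S) ^ 2 + norm2 (proj T) ^ 2 := by
    rw [hnormsq, hnormsq, hnormsq, Finset.sum_union hST]
  rw [hprojST] at lowST noiseST hunorm
  have pST := neg_le_of_abs_le (hpair S T hS hTk hST)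
  have pSR := neg_le_of_abs_le (htail S hS hSR)
  have pTR := neg_le_of_abs_le (htail T hTk hTR)
  have hcomm := dotProduct_comm (A.mulVec (proj T)) (A.mulVec (proj S))
  rw [hAh] at noiseS noiseT noiseST
  simp only [Matrix.mulVec_add, dotProduct_add, add_dotProduct] at noiseS noiseT lowST noiseST
  have hb := norm2_nonneg (proj S)
  have ht := norm2_nonneg (proj T)
  have hu := norm2_nonneg (proj S + proj T)
  have hB0 : 0 ≤ B :=
    div_nonneg (add_nonneg (mul_nonneg hq1 hα) hRsum) (Real.sqrt_nonneg _)
  change ∑ i ∈ Sᶜ, a i ≤ Real.sqrt (q + 1) * d * norm2 (proj S) + s at hcone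
  clear_value B proj
  rw [← hnorm] at hαT hTp
  have hcone' : Real.sqrt q * B ≤ Real.sqrt (q + 1) * d * norm2 (proj S) + s - p := by
    have := Finset.sum_sdiff (f := a) hTU
    rw [hBq, hR]
    linarith
  have hRsq : ∑ i ∈ R, a i ^ 2 ≤ norm2 (proj T) * B := by
    calc ∑ i ∈ R, a i ^ 2 ≤ ∑ i ∈ R, α * a i := Finset.sum_le_sum fun i hi => by
          rw [sq]; exact mul_le_mul_of_nonneg_right (hTα i hi) (ha i)
      _ = α * ∑ i ∈ R, a i := by rw [Finset.mul_sum]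
      _ ≤ α * (Real.sqrt q * B) := by
        rw [hBq]
        gcongr
        linarith [mul_nonneg hq1 hα]
      _ = (Real.sqrt q * α) * B := by ring
      _ ≤ norm2 (proj T) * B := mul_le_mul_of_nonneg_right hαT hB0
  have cancel : ∀ b r : ℝ, 0 ≤ b → 0 ≤ r → (1 - δ) * b ^ 2 ≤ b * r → (1 - δ) * b ≤ r := by
    intro b r hb hr hbr
    rcases hb.eq_or_lt with h0 | hpos
    · rw [← h0, mul_zero]; exact hr
    · exact le_of_mul_le_mul_left (by linarith) hpos
  have hH : norm2 h ^ 2 ≤ norm2 (proj S) ^ 2 + norm2 (proj T) ^ 2 + norm2 (proj T) * B := by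
    rw [hhsq]; linarith
  rcases tail_le_or_far_tail_le hq hb hp hs hd rfl hTp hcone' with hcase | hcase
  · refine error_bound_of_tail_le hb ht he hs hδ hd rfl rfl hw ?_ ?_ hH hcase
    · refine cancel _ _ hb (by positivity) ?_
      linarith
    · refine cancel _ _ ht (by positivity) ?_
      linarith
  · refine error_bound_of_far_tail_le hb ht hs he hδ hd rfl rfl hw hu hunorm ?_ hH hcase
    linarith

end Recovery

/-- sparse group LASSO, ℓ₂ bound. -/
theorem stmt15 {m n g k : ℕ} (hk : 0 < k)
    (G : Fin g → Finset (Fin n))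
    -- `G` is a partition of `{1,…,n}` with `l_min ≤ |G_j| ≤ l_max ≤ k`
    (hne : ∀ i, (G i).Nonempty)
    (hdisj : ∀ i j : Fin g, i ≠ j → Disjoint (G i) (G j))
    (hcover : Finset.univ.biUnion G = (Finset.univ : Finset (Fin n)))
    (lmin lmax : ℕ) (hlmin : 0 < lmin) (hlmax : lmax ≤ k)
    (hGcard : ∀ i, lmin ≤ (G i).card ∧ (G i).card ≤ lmax)
    -- `s_max = ⌊k / l_min⌋`
    (smax : ℕ) (hsmax : smax = k / lmin)
    -- the sparse group LASSO norm with parameter `μ ∈ [0,1]`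
    (μ : ℝ) (hμ0 : 0 ≤ μ) (hμ1 : μ ≤ 1)
    (SGL : (Fin n → ℝ) → ℝ)
    (hSGL : ∀ z, SGL z = ∑ j, ((1 - μ) * norm1 (restr (G j) z) + μ * norm2 (restr (G j) z)))
    -- `d = (1−μ)√l_max + μ√s_max`
    (d : ℝ) (hd : d = (1 - μ) * Real.sqrt lmax + μ * Real.sqrt smax)
    -- `A` satisfies GRIP of order `2k` with constant `δ = δ_{2k} < 1/(1+√2·d)`
    (A : Matrix (Fin m) (Fin n) ℝ)
    (δ : ℝ) (hδ0 : 0 < δ) (hδ : δ < 1 / (1 + Real.sqrt 2 * d))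
    (hGRIP : GRIP G A (2 * k) δ)
    -- measurements `y = Ax + η`, `‖η‖₂ ≤ ε`
    (x : Fin n → ℝ) (η : Fin m → ℝ) (ε : ℝ) (hε : 0 ≤ ε) (hη : norm2 η ≤ ε)
    (y : Fin m → ℝ) (hy : y = A.mulVec x + η)
    -- `x̂` minimizes `‖z‖_{SGL,μ}` subject to `‖y − Az‖₂ ≤ ε`
    (xh : Fin n → ℝ)
    (hfeas : norm2 (y - A.mulVec xh) ≤ ε)
    (hopt : ∀ z : Fin n → ℝ, norm2 (y - A.mulVec z) ≤ ε → SGL xh ≤ SGL z)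
    -- the group `k`-sparsity index `σ = σ_{k,𝒢}(x, ‖·‖_{SGL,μ})`
    (σ : ℝ)
    (hσ : σ = sInf {t : ℝ | ∃ Λ : Finset (Fin n), GkS G k Λ ∧ t = SGL (x - restr Λ x)}) :
    norm2 (xh - x)
      ≤ 2 * ((1 + (Real.sqrt 2 - 1) * δ) / (1 - (1 + Real.sqrt 2 * d) * δ)) * σ
        + 2 * (1 + d) * (Real.sqrt (1 + δ) / (1 - (1 + Real.sqrt 2 * d) * δ)) * ε := by
  have hd0 : 0 ≤ d := by
    have := sub_nonneg.2 hμ1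
    rw [hd]; positivity
  have hden : 0 < 1 + Real.sqrt 2 * d := by positivity
  have hw : 0 < 1 - (1 + Real.sqrt 2 * d) * δ := by
    have := (lt_div_iff₀ hden).1 hδ
    linarith
  have hSGL' : ∀ z, SGL z = ∑ j, groupTerm μ (G j) z := hSGL
  -- the infimum defining `σ` is attained
  obtain ⟨Λ, ⟨⟨S, rfl⟩, hSk⟩, hΛ⟩ : σ ∈ {t : ℝ | ∃ Λ : Finset (Fin n), GkS G k Λ ∧
      t = SGL (x - restr Λ x)} := by
    rw [hσ]
    refine Set.Nonempty.csInf_mem ⟨_, ∅, ⟨⟨∅, by simp⟩, by simp⟩, rfl⟩ ?_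
    refine (Set.finite_range fun Λ : Finset (Fin n) => SGL (x - restr Λ x)).subset ?_
    rintro _ ⟨Λ, -, rfl⟩
    exact ⟨Λ, rfl⟩
  rw [hSGL', sum_groupTerm_sub_restr hdisj] at hΛ
  have hσ0 : 0 ≤ σ := by
    rw [hΛ]
    exact Finset.sum_nonneg fun i _ => groupTerm_nonneg hμ0 hμ1 _ _
  have hδ1 : 0 ≤ 1 + (Real.sqrt 2 - 1) * δ := by
    have h21 : 1 ≤ Real.sqrt 2 := Real.one_le_sqrt.2 (by norm_num)
    have := mul_nonneg (sub_nonneg.2 h21) hδ0.le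
    linarith
  rcases isEmpty_or_nonempty (Fin g) with hg | ⟨⟨i₀⟩⟩
  · have hzero : norm2 (xh - x) = 0 := by
      have : (Finset.univ : Finset (Fin n)) = ∅ := by rw [← hcover]; simp
      rw [norm2, this]; simp
    rw [hzero]
    positivity
  have hlmax0 : 0 < lmax := hlmin.trans_le ((hGcard i₀).1.trans (hGcard i₀).2)
  have hq : 1 ≤ k / lmax := (Nat.one_le_div_iff hlmax0).2 hlmax
  have hkq : k ≤ (k / lmax + 1) * lmax := by
    have := Nat.lt_mul_div_succ k hlmax0
    rw [mul_comm]; exact this.le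
  have hfeasx : norm2 (y - A.mulVec x) ≤ ε := by
    rw [hy, add_sub_cancel_left]; exact hη
  have hopt' := hopt x hfeasx
  rw [hSGL', hSGL'] at hopt'
  have hScard : S.card ≤ smax := by
    rw [hsmax, Nat.le_div_iff_mul_le hlmin]
    exact (card_mul_le_card_biUnion hdisj (fun i => (hGcard i).1) S).trans hSk
  have hfactor : (1 - μ) * Real.sqrt (S.biUnion G).card + μ * Real.sqrt S.card
      ≤ Real.sqrt ((k / lmax : ℕ) + 1) * d := by
    have hμ' := sub_nonneg.2 hμ1
    have h1 : Real.sqrt (S.biUnion G).card ≤ Real.sqrt ((k / lmax : ℕ) + 1) * Real.sqrt lmax := by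
      rw [← Real.sqrt_mul (by positivity)]
      apply Real.sqrt_le_sqrt
      exact_mod_cast hSk.trans hkq
    have h2 : Real.sqrt S.card ≤ Real.sqrt ((k / lmax : ℕ) + 1) * Real.sqrt smax := by
      have h3 : Real.sqrt S.card ≤ Real.sqrt smax := Real.sqrt_le_sqrt (by exact_mod_cast hScard)
      have h4 : 1 ≤ Real.sqrt ((k / lmax : ℕ) + 1) := Real.one_le_sqrt.2 (by simp)
      exact h3.trans (le_mul_of_one_le_left (Real.sqrt_nonneg _) h4)
    calc _ ≤ (1 - μ) * (Real.sqrt ((k / lmax : ℕ) + 1) * Real.sqrt lmax)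
          + μ * (Real.sqrt ((k / lmax : ℕ) + 1) * Real.sqrt smax) := by gcongr
      _ = Real.sqrt ((k / lmax : ℕ) + 1) * d := by rw [hd]; ring
  have hcone : ∑ i ∈ Sᶜ, norm2 (restr (G i) (xh - x))
      ≤ Real.sqrt ((k / lmax : ℕ) + 1) * d * norm2 (restr (S.biUnion G) (xh - x)) + 2 * σ := by
    calc ∑ i ∈ Sᶜ, norm2 (restr (G i) (xh - x)) ≤ ∑ i ∈ Sᶜ, groupTerm μ (G i) (xh - x) :=
          Finset.sum_le_sum fun i _ => norm2_restr_le_groupTerm hμ1 _ _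
      _ ≤ ∑ i ∈ S, groupTerm μ (G i) (xh - x) + 2 * σ := by
        rw [hΛ]; exact sum_compl_groupTerm_le hμ0 hμ1 S x xh hopt'
      _ ≤ _ := by
        gcongr
        refine (sum_groupTerm_le hdisj hμ0 hμ1 S _).trans ?_
        exact mul_le_mul_of_nonneg_right hfactor (norm2_nonneg _)
  have hnoise : Real.sqrt (1 + δ) * norm2 (A.mulVec (xh - x)) ≤ 2 * Real.sqrt (1 + δ) * ε := by
    have h1 : A.mulVec (xh - x) = (y - A.mulVec x) - (y - A.mulVec xh) := by
      rw [Matrix.mulVec_sub]; abel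
    have h2 : norm2 (A.mulVec (xh - x)) ≤ ε + ε := by
      rw [h1]; exact (norm2_sub_le _ _).trans (add_le_add hfeasx hfeas)
    have h3 := mul_le_mul_of_nonneg_left h2 (Real.sqrt_nonneg (1 + δ))
    linarith
  have hbound := hGRIP.norm2_mul_le hdisj hcover (fun i => (hGcard i).2) hq
    (Nat.div_mul_le_self k lmax) hδ0.le hSk hd0 (by positivity) (by positivity) hw hcone hnoise
  have hrhs : 2 * ((1 + (Real.sqrt 2 - 1) * δ) / (1 - (1 + Real.sqrt 2 * d) * δ)) * σ
        + 2 * (1 + d) * (Real.sqrt (1 + δ) / (1 - (1 + Real.sqrt 2 * d) * δ)) * ε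
      = (2 * (1 + (Real.sqrt 2 - 1) * δ) * σ + 2 * (1 + d) * Real.sqrt (1 + δ) * ε)
        / (1 - (1 + Real.sqrt 2 * d) * δ) := by ring
  rw [hrhs, le_div_iff₀ hw]
  linarith
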